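/- Let Γ_n be the directed graph of isomorphism classes of cubic graphs on 2n vertices connected by Whitehead moves. Then its adjacency matrix A_n is primitive, i.e., A_n is a nonnegative integer matrix that is irreducible and aperiodic (equivalently, some power of A_n has all entries strictly positive). -/

import Mathlib

/-! Cubic multigraphs in the dart (half-edge) model, Whitehead moves,
and the "graph of graphs" `Γ_n`. -/

/-- A cubic multigraph on the `2 * n` vertices `Fin (2 * n)`, in the dart (half-edge) model:
darts are `Fin (6 * n)`, `dinv` is the fixed-point-free involution exchanging the two darts of
each edge, and `vert` assigns to each dart its base vertex.  Loops and multiple edges are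
allowed; `regular` says every vertex carries exactly three darts. -/
structure CubicGraph (n : ℕ) where
  vert : Fin (6 * n) → Fin (2 * n)
  dinv : Fin (6 * n) → Fin (6 * n)
  dinv_invol : ∀ d, dinv (dinv d) = d
  dinv_ne : ∀ d, dinv d ≠ d
  regular : ∀ v : Fin (2 * n), (Finset.univ.filter fun d => vert d = v).card = 3

namespace CubicGraph

variable {n : ℕ}

/-- Two darts are joined if they can be connected by a chain of
"same vertex" / "other half of the same edge" steps. -/
def Reach (g : CubicGraph n) : Fin (6 * n) → Fin (6 * n) → Prop :=
  Relation.ReflTransGen fun a b => g.vert a = g.vert b ∨ g.dinv a = b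

/-- Connectivity of a cubic multigraph. -/
def Connected (g : CubicGraph n) : Prop := ∀ d d', g.Reach d d'

/-- The edge of the dart `d` is a loop. -/
def IsLoop (g : CubicGraph n) (d : Fin (6 * n)) : Prop := g.vert (g.dinv d) = g.vert d

instance (g : CubicGraph n) (d : Fin (6 * n)) : Decidable (g.IsLoop d) :=
  inferInstanceAs (Decidable (_ = _))

lemma card_filter_comp_swap (g : CubicGraph n) (q r : Fin (6 * n)) (v : Fin (2 * n)) :
    (Finset.univ.filter fun d => g.vert (Equiv.swap q r d) = v).card
      = (Finset.univ.filter fun d => g.vert d = v).card := by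
  refine Finset.card_bij (fun d _ => Equiv.swap q r d) ?_ ?_ ?_
  · intro a ha
    simp only [Finset.mem_filter, Finset.mem_univ, true_and] at ha ⊢
    exact ha
  · intro a _ b _ h
    exact (Equiv.swap q r).injective h
  · intro b hb
    simp only [Finset.mem_filter, Finset.mem_univ, true_and] at hb
    exact ⟨Equiv.swap q r b, by simp [hb], by simp⟩

/-- Exchange the base vertices of the two darts `q` and `r`, keeping everything else. -/
def swapDarts (g : CubicGraph n) (q r : Fin (6 * n)) : CubicGraph n where
  vert := fun d => g.vert (Equiv.swap q r d)
  dinv := g.dinv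
  dinv_invol := g.dinv_invol
  dinv_ne := g.dinv_ne
  regular := fun v => (g.card_filter_comp_swap q r v).trans (g.regular v)

/-- The darts based at the same vertex as `x`, other than `x` itself. -/
def othersAt (g : CubicGraph n) (x : Fin (6 * n)) : Finset (Fin (6 * n)) :=
  (Finset.univ.filter fun d => g.vert d = g.vert x).erase x

lemma othersAt_nonempty (g : CubicGraph n) (x : Fin (6 * n)) :
    (g.othersAt x).Nonempty := by
  have hx : x ∈ Finset.univ.filter fun d => g.vert d = g.vert x := by simp
  have h : (g.othersAt x).card = 2 := by
    rw [othersAt, Finset.card_erase_of_mem hx, g.regular]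
  rw [← Finset.card_pos, h]
  norm_num

def oMin (g : CubicGraph n) (x : Fin (6 * n)) : Fin (6 * n) :=
  (g.othersAt x).min' (g.othersAt_nonempty x)

def oMax (g : CubicGraph n) (x : Fin (6 * n)) : Fin (6 * n) :=
  (g.othersAt x).max' (g.othersAt_nonempty x)

/-- The two Whitehead moves (indexed by `i : Fin 2`) performed on the edge containing the dart
`x`.  On a loop the move leaves the graph unchanged; on a non-loop edge the two darts at the
endpoints of the edge other than the edge's own darts are re-attached in one of the two
possible new ways (realized by transporting one dart from each endpoint to the other). -/
def wh (g : CubicGraph n) (i : Fin 2) (x : Fin (6 * n)) : CubicGraph n :=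
  if g.IsLoop x then g
  else if i = 0 then g.swapDarts (g.oMax x) (g.oMin (g.dinv x))
  else g.swapDarts (g.oMax x) (g.oMax (g.dinv x))

/-- An isomorphism of cubic multigraphs: a bijection of darts together with a compatible
bijection of vertices, commuting with the edge involutions. -/
structure Iso (g₁ g₂ : CubicGraph n) where
  dartEquiv : Fin (6 * n) ≃ Fin (6 * n)
  vertEquiv : Fin (2 * n) ≃ Fin (2 * n)
  map_dinv : ∀ d, g₂.dinv (dartEquiv d) = dartEquiv (g₁.dinv d)
  map_vert : ∀ d, g₂.vert (dartEquiv d) = vertEquiv (g₁.vert d)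

def IsIsomorphic (g₁ g₂ : CubicGraph n) : Prop := Nonempty (Iso g₁ g₂)

/-- Reachability avoiding the edge of the dart `x` (i.e. in the graph with that edge removed). -/
def ReachAvoiding (g : CubicGraph n) (x : Fin (6 * n)) :
    Fin (6 * n) → Fin (6 * n) → Prop :=
  Relation.ReflTransGen fun a b =>
    g.vert a = g.vert b ∨ (g.dinv a = b ∧ a ≠ x ∧ a ≠ g.dinv x)

/-- The edge of `x` is a bridge: removing it disconnects the graph. -/
def IsBridge (g : CubicGraph n) (x : Fin (6 * n)) : Prop :=
  ¬ ∀ d d', g.ReachAvoiding x d d'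

/-- A (connected) graph is bridged if it has at least one bridge. -/
def Bridged (g : CubicGraph n) : Prop := ∃ x, g.IsBridge x

/-- A graph is bridgeless if it has no bridge. -/
def Bridgeless (g : CubicGraph n) : Prop := ∀ x, ¬ g.IsBridge x

/-- `c` lists consecutive darts of a cycle of length `k`: the vertices visited are pairwise
distinct, the end of each dart's edge is the base of the next one (cyclically), and the `k`
edges used are pairwise distinct. -/
def IsCycle (g : CubicGraph n) (k : ℕ) (c : Fin k → Fin (6 * n)) : Prop :=
  (∀ i : Fin k,
    g.vert (g.dinv (c i)) = g.vert (c ⟨(i.1 + 1) % k, Nat.mod_lt _ i.pos⟩)) ∧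
  Function.Injective (fun i => g.vert (c i)) ∧
  ∀ i j : Fin k, c j ≠ g.dinv (c i)

/-- The cycle `c` is indecomposable (induced): no edge of `g` other than the cycle's own
edges joins two vertices of the cycle. -/
def Indecomposable (g : CubicGraph n) (k : ℕ) (c : Fin k → Fin (6 * n)) : Prop :=
  ∀ d, (∃ i, g.vert d = g.vert (c i)) → (∃ j, g.vert (g.dinv d) = g.vert (c j)) →
    ∃ i, d = c i ∨ d = g.dinv (c i)

/-- The girth: the least length of a cycle. -/
noncomputable def girth (g : CubicGraph n) : ℕ :=
  sInf {k | 0 < k ∧ ∃ c : Fin k → Fin (6 * n), g.IsCycle k c}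

/-- The only cycles of the graph are loops. -/
def OnlyLoopCycles (g : CubicGraph n) : Prop :=
  ∀ k, 2 ≤ k → ∀ c : Fin k → Fin (6 * n), ¬ g.IsCycle k c

/-- The number of darts lying on loops (each loop contributes two darts). -/
def loopCount (g : CubicGraph n) : ℕ :=
  (Finset.univ.filter fun d => g.IsLoop d).card

end CubicGraph

instance {n : ℕ} : Finite (CubicGraph n) := by
  have hinj : Function.Injective fun g : CubicGraph n => (g.vert, g.dinv) := by
    rintro ⟨v₁, i₁, _, _, _⟩ ⟨v₂, i₂, _, _, _⟩ h
    simp only [Prod.mk.injEq] at h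
    obtain ⟨h₁, h₂⟩ := h
    subst h₁; subst h₂; rfl
  exact Finite.of_injective _ hinj

/-- Isomorphism of connected cubic graphs. -/
def cgIso {n : ℕ} (g₁ g₂ : {g : CubicGraph n // g.Connected}) : Prop :=
  CubicGraph.IsIsomorphic g₁.1 g₂.1

/-- The vertex set of the graph of graphs `Γ_n`: isomorphism classes of connected cubic
multigraphs on `2 * n` vertices. -/
abbrev GammaV (n : ℕ) := Quot (@cgIso n)

/-- The number of directed edges of `Γ_n` from the class `u` to the class `v`: one edge for
each Whitehead move of a representative of `u` whose result lies in the class `v`.  A move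
specification is a pair `(i, x)` of a move type `i : Fin 2` and a dart `x`; each of the two
Whitehead moves of each edge is counted by exactly two specifications (one for each of the
two darts of the edge), whence the division by `2`. -/
noncomputable def edgeMult (n : ℕ) (u v : GammaV n) : ℕ :=
  Nat.card {p : Fin 2 × Fin (6 * n) //
    CubicGraph.IsIsomorphic ((Quot.out u).1.wh p.1 p.2) (Quot.out v).1} / 2

/-- The sum of out-degrees of the classes in `S` (every class has out-degree `6 * n`:
two Whitehead moves for each of the `3 * n` edges). -/
noncomputable def dOut (n : ℕ) (S : Set (GammaV n)) : ℕ :=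
  Nat.card {q : GammaV n × Fin 2 × Fin (6 * n) // q.1 ∈ S} / 2

/-- The number of directed edges of `Γ_n` from `S` to its complement. -/
noncomputable def boundaryCount (n : ℕ) (S : Set (GammaV n)) : ℕ :=
  Nat.card {q : GammaV n × Fin 2 × Fin (6 * n) // q.1 ∈ S ∧
    ∀ v : GammaV n,
      CubicGraph.IsIsomorphic ((Quot.out q.1).1.wh q.2.1 q.2.2) (Quot.out v).1 → v ∉ S} / 2

/-- The outer conductance of a set `S` of vertices of `Γ_n`. -/
noncomputable def phiOutSet (n : ℕ) (S : Set (GammaV n)) : ℝ :=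
  (boundaryCount n S : ℝ) / min (dOut n S : ℝ) (dOut n Sᶜ : ℝ)

/-- The outer conductance of `Γ_n`: the infimum of the outer conductances of nonempty
proper subsets of vertices. -/
noncomputable def phiOut (n : ℕ) : ℝ :=
  sInf {x : ℝ | ∃ S : Set (GammaV n), S.Nonempty ∧ Sᶜ.Nonempty ∧ x = phiOutSet n S}

/-- The set of classes of bridged cubic graphs. -/
def bridgedSet (n : ℕ) : Set (GammaV n) := {u | (Quot.out u).1.Bridged}

noncomputable instance {n : ℕ} : Fintype (GammaV n) := Fintype.ofFinite _

noncomputable instance {n : ℕ} : DecidableEq (GammaV n) := Classical.decEq _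

/-- The adjacency matrix of `Γ_n`, as a matrix of natural numbers. -/
noncomputable def adjMatN (n : ℕ) : Matrix (GammaV n) (GammaV n) ℕ :=
  fun u v => edgeMult n u v

/-- The adjacency matrix of `Γ_n`, over the reals. -/
noncomputable def adjMatR (n : ℕ) : Matrix (GammaV n) (GammaV n) ℝ :=
  fun u v => (edgeMult n u v : ℝ)

/-- The adjacency matrix of `Γ_n`, over the complex numbers. -/
noncomputable def adjMatC (n : ℕ) : Matrix (GammaV n) (GammaV n) ℂ :=
  fun u v => (edgeMult n u v : ℂ)

/-- The number of directed paths of length `ℓ` in `Γ_n` (entries of the `ℓ`-th power of the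
adjacency matrix, summed). -/
noncomputable def pathCount (n ℓ : ℕ) : ℝ :=
  ∑ u : GammaV n, ∑ v : GammaV n, (adjMatR n ^ ℓ) u v

/-- A Perron number: a real algebraic integer `ρ > 1` all of whose other Galois conjugates
have modulus strictly less than `ρ`. -/
def IsPerron (ρ : ℝ) : Prop :=
  1 < ρ ∧ IsIntegral ℤ ρ ∧
    ∀ z : ℂ, Polynomial.aeval z (minpoly ℤ ρ) = 0 → z ≠ (ρ : ℂ) → ‖z‖ < ρ


namespace CubicGraph

variable {n : ℕ}

@[ext]
lemma ext_vert_dinv {g h : CubicGraph n} (hv : ∀ d, g.vert d = h.vert d)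
    (hd : ∀ d, g.dinv d = h.dinv d) : g = h := by
  obtain ⟨v₁, i₁, _, _, _⟩ := g
  obtain ⟨v₂, i₂, _, _, _⟩ := h
  obtain rfl : v₁ = v₂ := funext hv
  obtain rfl : i₁ = i₂ := funext hd
  rfl

lemma dinv_injective (g : CubicGraph n) : Function.Injective g.dinv :=
  Function.Involutive.injective g.dinv_invol

/-! ### Isomorphisms -/

lemma IsIsomorphic.refl (g : CubicGraph n) : g.IsIsomorphic g :=
  ⟨⟨Equiv.refl _, Equiv.refl _, fun _ => rfl, fun _ => rfl⟩⟩

lemma IsIsomorphic.symm {g h : CubicGraph n} : g.IsIsomorphic h → h.IsIsomorphic g := by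
  rintro ⟨φ, τ, hd, hv⟩
  refine ⟨⟨φ.symm, τ.symm, fun d => ?_, fun d => ?_⟩⟩
  · rw [Equiv.eq_symm_apply, ← hd, Equiv.apply_symm_apply]
  · rw [Equiv.eq_symm_apply, ← hv, Equiv.apply_symm_apply]

lemma IsIsomorphic.trans {g h k : CubicGraph n} :
    g.IsIsomorphic h → h.IsIsomorphic k → g.IsIsomorphic k := by
  rintro ⟨φ, τ, hd, hv⟩ ⟨φ', τ', hd', hv'⟩
  exact ⟨⟨φ.trans φ', τ.trans τ', fun d => by simp [hd, hd'], fun d => by simp [hv, hv']⟩⟩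

/-- Transport of a cubic graph along bijections of its darts and of its vertices. -/
def relabel (g : CubicGraph n) (φ : Equiv.Perm (Fin (6 * n))) (τ : Equiv.Perm (Fin (2 * n))) :
    CubicGraph n where
  vert := fun d => τ (g.vert (φ.symm d))
  dinv := fun d => φ (g.dinv (φ.symm d))
  dinv_invol := fun d => by simp [g.dinv_invol]
  dinv_ne := fun d h => g.dinv_ne (φ.symm d) (by rw [Equiv.eq_symm_apply, h])
  regular := fun v => by
    rw [← g.regular (τ.symm v)]
    refine Finset.card_bij (fun d _ => φ.symm d) ?_ (fun a _ b _ h => φ.symm.injective h) ?_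
    · intro a ha
      simpa [Equiv.eq_symm_apply] using ha
    · intro b hb
      refine ⟨φ b, ?_, by simp⟩
      simpa [Equiv.eq_symm_apply] using hb

lemma isIsomorphic_relabel (g : CubicGraph n) (φ : Equiv.Perm (Fin (6 * n)))
    (τ : Equiv.Perm (Fin (2 * n))) : g.IsIsomorphic (g.relabel φ τ) :=
  ⟨⟨φ, τ, fun d => by simp [relabel], fun d => by simp [relabel]⟩⟩

lemma Iso.isIsomorphic_swapDarts {g h : CubicGraph n} (f : Iso g h) (a c : Fin (6 * n)) :
    (g.swapDarts a c).IsIsomorphic (h.swapDarts (f.dartEquiv a) (f.dartEquiv c)) := by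
  refine ⟨⟨f.dartEquiv, f.vertEquiv, f.map_dinv, fun d => ?_⟩⟩
  simp only [swapDarts]
  rw [← f.map_vert, f.dartEquiv.injective.map_swap]

lemma IsIsomorphic.connected {g h : CubicGraph n} (hgh : g.IsIsomorphic h) (hg : g.Connected) :
    h.Connected := by
  obtain ⟨φ, τ, hd, hv⟩ := hgh
  intro d d'
  have key : ∀ a b, g.Reach a b → h.Reach (φ a) (φ b) := by
    intro a b hab
    refine Relation.ReflTransGen.lift φ ?_ _ _ hab
    rintro a b (h1 | h1)
    · left; rw [hv, hv, h1]
    · right; rw [hd, h1]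
  simpa using key _ _ (hg (φ.symm d) (φ.symm d'))

/-! ### Swaps across an edge -/

/-- `h` arises from `g` by exchanging a dart at one endpoint of a non-loop edge with a dart at
the other endpoint. -/
def EdgeSwap (g h : CubicGraph n) : Prop :=
  ∃ x a c, ¬ g.IsLoop x ∧ a ≠ x ∧ g.vert a = g.vert x ∧ c ≠ g.dinv x ∧
    g.vert c = g.vert (g.dinv x) ∧ h = g.swapDarts a c

lemma swapDarts_swapDarts (g : CubicGraph n) (a c : Fin (6 * n)) :
    (g.swapDarts a c).swapDarts c a = g := by
  ext d
  · simp [swapDarts, Equiv.swap_comm c a]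
  · rfl

lemma swapDarts_of_vert_eq (g : CubicGraph n) {a c : Fin (6 * n)} (h : g.vert a = g.vert c) :
    g.swapDarts a c = g := by
  ext d
  · simp only [swapDarts, Equiv.swap_apply_def]
    split_ifs with h1 h2 <;> simp_all
  · rfl

lemma vert_swapDarts_left (g : CubicGraph n) (a c : Fin (6 * n)) :
    (g.swapDarts a c).vert a = g.vert c := by simp [swapDarts]

lemma vert_swapDarts_right (g : CubicGraph n) (a c : Fin (6 * n)) :
    (g.swapDarts a c).vert c = g.vert a := by simp [swapDarts]

lemma vert_swapDarts_of_ne (g : CubicGraph n) {a c d : Fin (6 * n)} (ha : d ≠ a) (hc : d ≠ c) :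
    (g.swapDarts a c).vert d = g.vert d := by
  simp [swapDarts, Equiv.swap_apply_of_ne_of_ne ha hc]

lemma EdgeSwap.symm {g h : CubicGraph n} : EdgeSwap g h → EdgeSwap h g := by
  rintro ⟨x, a, c, hx, hax, hva, hcx, hvc, rfl⟩
  have hxa : g.dinv x ≠ a := by rintro rfl; exact hx hva
  have hxc : x ≠ c := by rintro rfl; exact hx hvc.symm
  have h1 : (g.swapDarts a c).vert x = g.vert x := g.vert_swapDarts_of_ne hax.symm hxc
  have h2 : (g.swapDarts a c).vert (g.dinv x) = g.vert (g.dinv x) :=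
    g.vert_swapDarts_of_ne hxa hcx.symm
  refine ⟨x, c, a, ?_, hxc.symm, ?_, hxa.symm, ?_, (g.swapDarts_swapDarts a c).symm⟩
  · unfold IsLoop
    rw [h1]; exact fun h => hx (h2.symm.trans h)
  · rw [h1, vert_swapDarts_right, hva]
  · rw [vert_swapDarts_left, hvc]; exact h2.symm

lemma Reach.symm {g : CubicGraph n} {a b : Fin (6 * n)} (h : g.Reach a b) : g.Reach b a := by
  unfold Reach at h ⊢
  induction h with
  | refl => exact .refl
  | tail _ hcd ih =>
    refine .head ?_ ih
    obtain hcd | hcd := hcd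
    · exact .inl hcd.symm
    · exact .inr (by rw [← hcd, g.dinv_invol])

lemma EdgeSwap.connected {g h : CubicGraph n} (hgh : EdgeSwap g h) (hg : g.Connected) :
    h.Connected := by
  obtain ⟨x, a, c, hx, hax, hva, hcx, hvc, rfl⟩ := hgh
  have hxa : g.dinv x ≠ a := by rintro rfl; exact hx hva
  have hxc : x ≠ c := by rintro rfl; exact hx hvc.symm
  set h := g.swapDarts a c with hh
  have h1 : h.vert x = g.vert x := g.vert_swapDarts_of_ne hax.symm hxc
  have h2 : h.vert (g.dinv x) = g.vert (g.dinv x) :=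
    g.vert_swapDarts_of_ne hxa hcx.symm
  have key : ∀ e, h.vert e = g.vert x ∨ h.vert e = g.vert (g.dinv x) → h.Reach e x := by
    rintro e (he | he)
    · exact .single (.inl (he.trans h1.symm))
    · exact .tail (.single (.inl (he.trans h2.symm))) (.inr (g.dinv_invol x))
  have key2 : ∀ e, g.vert e = g.vert x ∨ g.vert e = g.vert (g.dinv x) → h.Reach e x := by
    intro e he
    apply key
    by_cases hea : e = a
    · right; rw [hea, hh, vert_swapDarts_left, hvc]
    by_cases hec : e = c
    · left; rw [hec, hh, vert_swapDarts_right, hva]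
    rwa [hh, vert_swapDarts_of_ne _ hea hec]
  intro d d'
  have := hg d d'
  unfold Reach at this
  induction this with
  | refl => exact .refl
  | @tail e f _ hef ih =>
    refine Relation.ReflTransGen.trans ih ?_
    obtain hef | hef := hef
    · by_cases he : g.vert e = g.vert x ∨ g.vert e = g.vert (g.dinv x)
      · exact (key2 e he).trans (key2 f (hef ▸ he)).symm
      · have hf := he
        rw [hef] at hf
        push Not at he hf
        refine .single (.inl ?_)
        rw [hh, vert_swapDarts_of_ne, vert_swapDarts_of_ne, hef]
        · rintro rfl; exact hf.1 hva
        · rintro rfl; exact hf.2 hvc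
        · rintro rfl; exact he.1 hva
        · rintro rfl; exact he.2 hvc
    · exact .single (.inr hef)

/-! ### Whitehead moves as swaps -/

lemma mem_othersAt {g : CubicGraph n} {x d : Fin (6 * n)} :
    d ∈ g.othersAt x ↔ d ≠ x ∧ g.vert d = g.vert x := by
  simp [othersAt]

lemma card_othersAt (g : CubicGraph n) (x : Fin (6 * n)) : (g.othersAt x).card = 2 := by
  have hx : x ∈ Finset.univ.filter fun d => g.vert d = g.vert x := by simp
  rw [othersAt, Finset.card_erase_of_mem hx, g.regular]

lemma othersAt_eq (g : CubicGraph n) (x : Fin (6 * n)) :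
    g.oMin x ≠ g.oMax x ∧ g.othersAt x = {g.oMin x, g.oMax x} := by
  have hne : g.oMin x ≠ g.oMax x :=
    (Finset.min'_lt_max'_of_card _ (by rw [card_othersAt]; norm_num)).ne
  refine ⟨hne, (Finset.eq_of_subset_of_card_le ?_ ?_).symm⟩
  · intro d hd
    simp only [Finset.mem_insert, Finset.mem_singleton] at hd
    obtain rfl | rfl := hd
    · exact Finset.min'_mem _ _
    · exact Finset.max'_mem _ _
  · rw [card_othersAt, Finset.card_pair hne]

lemma isIsomorphic_swapDarts_swapDarts (g : CubicGraph n) {x a b c d : Fin (6 * n)}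
    (hx : ¬ g.IsLoop x) (hab : a ≠ b) (hu : g.othersAt x = {a, b})
    (hcd : c ≠ d) (hv : g.othersAt (g.dinv x) = {c, d}) :
    (g.swapDarts a c).IsIsomorphic (g.swapDarts b d) := by
  have hu' : ∀ e, e ≠ x ∧ g.vert e = g.vert x ↔ e = a ∨ e = b := fun e => by
    rw [← mem_othersAt, hu]; simp
  have hv' : ∀ e, e ≠ g.dinv x ∧ g.vert e = g.vert (g.dinv x) ↔ e = c ∨ e = d := fun e => by
    rw [← mem_othersAt, hv]; simp
  unfold IsLoop at hx
  refine ⟨⟨Equiv.swap x (g.dinv x), Equiv.swap (g.vert x) (g.vert (g.dinv x)), fun e => ?_,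
    fun e => ?_⟩⟩
  · have hinv := g.dinv_invol
    change g.dinv (Equiv.swap x (g.dinv x) e) = Equiv.swap x (g.dinv x) (g.dinv e)
    by_cases h1 : e = x
    · subst h1; simp [hinv]
    by_cases h2 : e = g.dinv x
    · subst h2; simp [hinv]
    rw [Equiv.swap_apply_of_ne_of_ne h1 h2, Equiv.swap_apply_of_ne_of_ne]
    · rintro rfl; exact h2 (hinv e).symm
    · exact fun h => h1 (g.dinv_injective h)
  · have ha := (hu' a).2 (.inl rfl)
    have hb := (hu' b).2 (.inr rfl)
    have hc := (hv' c).2 (.inl rfl)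
    have hd := (hv' d).2 (.inr rfl)
    simp only [swapDarts]
    have h3 := hu' e
    have h4 := hv' e
    clear hu' hv' hu hv
    simp only [Equiv.swap_apply_def]
    grind

/-- Some Whitehead move takes `g` to a graph isomorphic to `h`. -/
def WhStep (g h : CubicGraph n) : Prop := ∃ i x, (g.wh i x).IsIsomorphic h

lemma wh_of_isLoop {g : CubicGraph n} {x : Fin (6 * n)} (hx : g.IsLoop x) (i : Fin 2) :
    g.wh i x = g := by simp [wh, hx]

lemma wh_zero {g : CubicGraph n} {x : Fin (6 * n)} (hx : ¬ g.IsLoop x) :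
    g.wh 0 x = g.swapDarts (g.oMax x) (g.oMin (g.dinv x)) := by simp [wh, hx]

lemma wh_one {g : CubicGraph n} {x : Fin (6 * n)} (hx : ¬ g.IsLoop x) :
    g.wh 1 x = g.swapDarts (g.oMax x) (g.oMax (g.dinv x)) := by simp [wh, hx]

lemma swapDarts_comm (g : CubicGraph n) (a c : Fin (6 * n)) :
    g.swapDarts a c = g.swapDarts c a := by
  simp [swapDarts, Equiv.swap_comm c a]

lemma wh_dinv (g : CubicGraph n) (i : Fin 2) (x : Fin (6 * n)) :
    (g.wh i x).IsIsomorphic (g.wh i (g.dinv x)) := by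
  by_cases hx : g.IsLoop x
  · have hx' : g.IsLoop (g.dinv x) := by
      unfold IsLoop at hx ⊢; rw [g.dinv_invol, hx]
    rw [wh_of_isLoop hx, wh_of_isLoop hx']
    exact .refl g
  · have hx' : ¬ g.IsLoop (g.dinv x) := by
      unfold IsLoop at hx ⊢; rw [g.dinv_invol]; exact fun h => hx h.symm
    obtain ⟨hne, hu⟩ := g.othersAt_eq x
    obtain ⟨hne', hv⟩ := g.othersAt_eq (g.dinv x)
    fin_cases i
    · simp only [Fin.zero_eta, wh_zero hx, wh_zero hx', g.dinv_invol]
      rw [g.swapDarts_comm (g.oMax (g.dinv x))]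
      exact g.isIsomorphic_swapDarts_swapDarts hx hne.symm (by rw [hu, Finset.pair_comm]) hne' hv
    · simp only [Fin.mk_one, wh_one hx, wh_one hx', g.dinv_invol]
      rw [g.swapDarts_comm (g.oMax (g.dinv x))]
      exact .refl _

lemma EdgeSwap.whStep {g h : CubicGraph n} (hgh : EdgeSwap g h) : WhStep g h := by
  obtain ⟨x, a, c, hx, hax, hva, hcx, hvc, rfl⟩ := hgh
  obtain ⟨hne, hu⟩ := g.othersAt_eq x
  obtain ⟨hne', hv⟩ := g.othersAt_eq (g.dinv x)
  have ha := mem_othersAt.2 ⟨hax, hva⟩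
  have hc := mem_othersAt.2 ⟨hcx, hvc⟩
  rw [hu, Finset.mem_insert, Finset.mem_singleton] at ha
  rw [hv, Finset.mem_insert, Finset.mem_singleton] at hc
  obtain rfl | rfl := ha <;> obtain rfl | rfl := hc
  · exact ⟨1, x, wh_one hx ▸ (g.isIsomorphic_swapDarts_swapDarts hx hne hu hne' hv).symm⟩
  · exact ⟨0, x, wh_zero hx ▸ (g.isIsomorphic_swapDarts_swapDarts hx hne hu hne'.symm
      (by rw [hv, Finset.pair_comm])).symm⟩
  · exact ⟨0, x, wh_zero hx ▸ .refl _⟩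
  · exact ⟨1, x, wh_one hx ▸ .refl _⟩

lemma whStep_iff {g h : CubicGraph n} :
    WhStep g h ↔ (∃ x, g.IsLoop x) ∧ g.IsIsomorphic h ∨
      ∃ k, EdgeSwap g k ∧ k.IsIsomorphic h := by
  constructor
  · rintro ⟨i, x, hi⟩
    by_cases hx : g.IsLoop x
    · rw [wh_of_isLoop hx] at hi
      exact .inl ⟨⟨x, hx⟩, hi⟩
    · refine .inr ⟨_, ?_, hi⟩
      have h1 := mem_othersAt.1 (Finset.max'_mem _ (g.othersAt_nonempty x))
      have h2 := mem_othersAt.1 (Finset.min'_mem _ (g.othersAt_nonempty (g.dinv x)))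
      have h3 := mem_othersAt.1 (Finset.max'_mem _ (g.othersAt_nonempty (g.dinv x)))
      fin_cases i
      · exact ⟨x, _, _, hx, h1.1, h1.2, h2.1, h2.2, wh_zero hx⟩
      · exact ⟨x, _, _, hx, h1.1, h1.2, h3.1, h3.2, wh_one hx⟩
  · rintro (⟨⟨x, hx⟩, hi⟩ | ⟨k, hk, hi⟩)
    · exact ⟨0, x, by rwa [wh_of_isLoop hx]⟩
    · obtain ⟨i, x, hj⟩ := hk.whStep
      exact ⟨i, x, hj.trans hi⟩

lemma WhStep.congr {g g' h h' : CubicGraph n} (hg : g.IsIsomorphic g') (hh : h.IsIsomorphic h')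
    (hs : WhStep g h) : WhStep g' h' := by
  rw [whStep_iff] at hs ⊢
  obtain ⟨⟨x, hx⟩, hi⟩ | ⟨k, ⟨x, a, c, hx, hax, hva, hcx, hvc, rfl⟩, hi⟩ := hs
  · refine .inl ⟨?_, hg.symm.trans (hi.trans hh)⟩
    obtain ⟨f⟩ := hg
    refine ⟨f.dartEquiv x, ?_⟩
    unfold IsLoop at hx ⊢
    rw [f.map_dinv, f.map_vert, f.map_vert, hx]
  · obtain ⟨f⟩ := hg
    refine .inr ⟨_, ⟨f.dartEquiv x, f.dartEquiv a, f.dartEquiv c, ?_, ?_, ?_, ?_, ?_, rfl⟩,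
      (f.isIsomorphic_swapDarts a c).symm.trans (hi.trans hh)⟩
    · unfold IsLoop at hx ⊢
      rw [f.map_dinv, f.map_vert, f.map_vert]
      exact fun h => hx (f.vertEquiv.injective h)
    · exact f.dartEquiv.injective.ne hax
    · rw [f.map_vert, f.map_vert, hva]
    · rw [f.map_dinv]; exact f.dartEquiv.injective.ne hcx
    · rw [f.map_dinv, f.map_vert, f.map_vert, hvc]

end CubicGraph

namespace CubicGraph

variable {n : ℕ}

/-! ### Equivalence under swaps and isomorphisms -/

/-- `h` can be reached from `g` by edge swaps and isomorphisms. -/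
def SwapReach : CubicGraph n → CubicGraph n → Prop :=
  Relation.ReflTransGen fun g h => EdgeSwap g h ∨ g.IsIsomorphic h

lemma SwapReach.refl (g : CubicGraph n) : SwapReach g g := Relation.ReflTransGen.refl

lemma SwapReach.trans {g h k : CubicGraph n} (h1 : SwapReach g h) (h2 : SwapReach h k) :
    SwapReach g k := Relation.ReflTransGen.trans h1 h2

lemma EdgeSwap.swapReach {g h : CubicGraph n} (hgh : EdgeSwap g h) : SwapReach g h :=
  Relation.ReflTransGen.single (.inl hgh)

lemma IsIsomorphic.swapReach {g h : CubicGraph n} (hgh : g.IsIsomorphic h) : SwapReach g h :=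
  Relation.ReflTransGen.single (.inr hgh)

lemma SwapReach.symm {g h : CubicGraph n} (hgh : SwapReach g h) : SwapReach h g := by
  unfold SwapReach at hgh
  induction hgh with
  | refl => exact .refl _
  | tail _ hcd ih =>
    refine SwapReach.trans ?_ ih
    obtain hcd | hcd := hcd
    · exact hcd.symm.swapReach
    · exact hcd.symm.swapReach

lemma SwapReach.connected {g h : CubicGraph n} (hgh : SwapReach g h) (hg : g.Connected) :
    h.Connected := by
  unfold SwapReach at hgh
  induction hgh with
  | refl => exact hg
  | tail _ hcd ih =>
    obtain hcd | hcd := hcd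
    · exact hcd.connected ih
    · exact hcd.connected ih

/-! ### Paths and the darts hanging off them -/

/-- A path with `k` edges: the `i`-th edge is that of the dart `s i` and leads from the vertex
`v i` to `v (i + 1)`, and the vertices `v 0, …, v k` are distinct. -/
structure IsPath (g : CubicGraph n) (k : ℕ) (s : ℕ → Fin (6 * n)) (v : ℕ → Fin (2 * n)) :
    Prop where
  vert_eq : ∀ i < k, g.vert (s i) = v i
  vert_dinv_eq : ∀ i < k, g.vert (g.dinv (s i)) = v (i + 1)
  inj : ∀ i ≤ k, ∀ j ≤ k, v i = v j → i = j

/-- The dart `d` lies on none of the first `k` edges of the sequence `s`. -/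
def OffPath (g : CubicGraph n) (k : ℕ) (s : ℕ → Fin (6 * n)) (d : Fin (6 * n)) : Prop :=
  ∀ i < k, d ≠ s i ∧ d ≠ g.dinv (s i)

lemma exists_dart_ne_ne (g : CubicGraph n) (w : Fin (2 * n)) (a b : Fin (6 * n)) :
    ∃ d, g.vert d = w ∧ d ≠ a ∧ d ≠ b := by
  have hlt : ({a, b} : Finset (Fin (6 * n))).card
      < (Finset.univ.filter fun d => g.vert d = w).card := by
    rw [g.regular]
    exact Finset.card_le_two.trans_lt (by norm_num)
  obtain ⟨d, hd, hd'⟩ := Finset.exists_mem_notMem_of_card_lt_card hlt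
  simp only [Finset.mem_filter, Finset.mem_univ, true_and, Finset.mem_insert,
    Finset.mem_singleton, not_or] at hd hd'
  exact ⟨d, hd, hd'⟩

lemma OffPath.dinv {g : CubicGraph n} {k : ℕ} {s : ℕ → Fin (6 * n)} {d : Fin (6 * n)}
    (hd : g.OffPath k s d) : g.OffPath k s (g.dinv d) := by
  intro i hi
  refine ⟨?_, fun h => (hd i hi).1 (g.dinv_injective h)⟩
  intro h
  exact (hd i hi).2 (by rw [← h, g.dinv_invol])

lemma IsPath.swapDarts {g : CubicGraph n} {k : ℕ} {s : ℕ → Fin (6 * n)} {v : ℕ → Fin (2 * n)}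
    (hp : g.IsPath k s v) {p q : Fin (6 * n)} (hpo : g.OffPath k s p) (hqo : g.OffPath k s q) :
    (g.swapDarts p q).IsPath k s v := by
  refine ⟨fun i hi => ?_, fun i hi => ?_, hp.inj⟩
  · rw [vert_swapDarts_of_ne _ (hpo i hi).1.symm (hqo i hi).1.symm, hp.vert_eq i hi]
  · rw [show (g.swapDarts p q).dinv (s i) = g.dinv (s i) from rfl,
      vert_swapDarts_of_ne _ (hpo i hi).2.symm (hqo i hi).2.symm, hp.vert_dinv_eq i hi]

lemma IsPath.offPath {g : CubicGraph n} {k : ℕ} {s : ℕ → Fin (6 * n)} {v : ℕ → Fin (2 * n)}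
    (hp : g.IsPath k s v) {i : ℕ} (hi : i ≤ k) {d : Fin (6 * n)} (hd : g.vert d = v i)
    (h1 : d ≠ s i) (h2 : ∀ j, j + 1 = i → d ≠ g.dinv (s j)) : g.OffPath k s d := by
  refine fun j hj => ⟨?_, ?_⟩
  · rintro rfl
    rw [hp.vert_eq j hj] at hd
    obtain rfl := hp.inj j hj.le i hi hd
    exact h1 rfl
  · rintro rfl
    rw [hp.vert_dinv_eq j hj] at hd
    exact h2 j (hp.inj (j + 1) hj i hi hd) rfl

lemma IsPath.exists_offPath {g : CubicGraph n} {k : ℕ} {s : ℕ → Fin (6 * n)}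
    {v : ℕ → Fin (2 * n)} (hp : g.IsPath k s v) {i : ℕ} (hi : i ≤ k) :
    ∃ d, g.vert d = v i ∧ g.OffPath k s d := by
  obtain ⟨d, hd, h1, h2⟩ := g.exists_dart_ne_ne (v i) (s i) (g.dinv (s (i - 1)))
  refine ⟨d, hd, hp.offPath hi hd h1 ?_⟩
  rintro j rfl
  simpa using h2

lemma IsPath.edgeSwap {g : CubicGraph n} {k : ℕ} {s : ℕ → Fin (6 * n)} {v : ℕ → Fin (2 * n)}
    (hp : g.IsPath k s v) {i : ℕ} (hi : i < k) {p q : Fin (6 * n)} (hpo : g.OffPath k s p)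
    (hqo : g.OffPath k s q) (hpv : g.vert p = v i) (hqv : g.vert q = v (i + 1)) :
    EdgeSwap g (g.swapDarts p q) := by
  refine ⟨s i, p, q, ?_, (hpo i hi).1, ?_, (hqo i hi).2, ?_, rfl⟩
  · unfold IsLoop
    rw [hp.vert_eq i hi, hp.vert_dinv_eq i hi]
    intro h
    have := hp.inj _ hi _ hi.le h
    omega
  · rw [hpv, hp.vert_eq i hi]
  · rw [hqv, hp.vert_dinv_eq i hi]

lemma swapDarts_conj (g : CubicGraph n) {p q r : Fin (6 * n)} (hpq : p ≠ q) (hpr : p ≠ r)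
    (hqr : q ≠ r) :
    ((g.swapDarts p r).swapDarts p q).swapDarts r q = g.swapDarts p q := by
  ext d
  · simp only [swapDarts, Equiv.swap_apply_def]
    grind
  · rfl

lemma IsPath.swapReach_of_le {k : ℕ} {s : ℕ → Fin (6 * n)} {v : ℕ → Fin (2 * n)} (m : ℕ) :
    ∀ {g : CubicGraph n}, g.IsPath k s v → ∀ {i : ℕ} {p q : Fin (6 * n)}, i + m ≤ k →
      g.OffPath k s p → g.OffPath k s q → g.vert p = v i → g.vert q = v (i + m) →
      SwapReach g (g.swapDarts p q) := by
  induction m with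
  | zero =>
    intro g hp i p q hi hpo hqo hpv hqv
    rw [g.swapDarts_of_vert_eq (hpv.trans hqv.symm)]
    exact .refl g
  | succ m ih =>
    intro g hp i p q hi hpo hqo hpv hqv
    obtain rfl | hm := Nat.eq_zero_or_pos m
    · exact (hp.edgeSwap hi hpo hqo hpv hqv).swapReach
    obtain ⟨r, hrv, hro⟩ := hp.exists_offPath (i := i + 1) (by omega)
    have hne : ∀ j l, j ≤ k → l ≤ k → j ≠ l → v j ≠ v l :=
      fun j l hj hl hjl h => hjl (hp.inj j hj l hl h)
    have hpq : p ≠ q := by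
      rintro rfl; exact hne i (i + (m + 1)) (by omega) hi (by omega) (hpv.symm.trans hqv)
    have hpr : p ≠ r := by
      rintro rfl; exact hne i (i + 1) (by omega) (by omega) (by omega) (hpv.symm.trans hrv)
    have hqr : q ≠ r := by
      rintro rfl
      exact hne (i + (m + 1)) (i + 1) hi (by omega) (by omega) (hqv.symm.trans hrv)
    rw [← g.swapDarts_conj hpq hpr hqr]
    have hp1 := hp.swapDarts hpo hro
    have hp2 := hp1.swapDarts (p := p) (q := q) hpo hqo
    refine (hp.edgeSwap (by omega) hpo hro hpv hrv).swapReach.trans ((ih hp1 (i := i + 1)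
      (by omega) hpo hqo ?_ ?_).trans (hp2.edgeSwap (i := i) (by omega) hro hqo ?_ ?_).swapReach)
    · rw [vert_swapDarts_left, hrv]
    · rw [vert_swapDarts_of_ne _ hpq.symm hqr, hqv]; congr 1; omega
    · rw [vert_swapDarts_of_ne _ hpr.symm hqr.symm, vert_swapDarts_right, hpv]
    · rw [vert_swapDarts_right, vert_swapDarts_left, hrv]

lemma IsPath.swapReach {g : CubicGraph n} {k : ℕ} {s : ℕ → Fin (6 * n)} {v : ℕ → Fin (2 * n)}
    (hp : g.IsPath k s v) {i j : ℕ} {p q : Fin (6 * n)} (hi : i ≤ k) (hj : j ≤ k)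
    (hpo : g.OffPath k s p) (hqo : g.OffPath k s q) (hpv : g.vert p = v i)
    (hqv : g.vert q = v j) : SwapReach g (g.swapDarts p q) := by
  obtain hij | hij := le_total i j
  · obtain ⟨m, rfl⟩ := Nat.exists_eq_add_of_le hij
    exact hp.swapReach_of_le m hj hpo hqo hpv hqv
  · obtain ⟨m, rfl⟩ := Nat.exists_eq_add_of_le hij
    rw [swapDarts_comm]
    exact hp.swapReach_of_le m hi hqo hpo hqv hpv

/-! ### Growing a Hamiltonian path -/

lemma exists_dart (g : CubicGraph n) (w : Fin (2 * n)) : ∃ d, g.vert d = w := by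
  have h : (Finset.univ.filter fun d => g.vert d = w).Nonempty := by
    rw [← Finset.card_pos, g.regular]; norm_num
  obtain ⟨d, hd⟩ := h
  exact ⟨d, by simpa using hd⟩

lemma Connected.exists_boundary_dart {g : CubicGraph n} (hg : g.Connected) {S : Set (Fin (2 * n))}
    {a b : Fin (2 * n)} (ha : a ∈ S) (hb : b ∉ S) :
    ∃ y, g.vert y ∈ S ∧ g.vert (g.dinv y) ∉ S := by
  by_contra! hcon
  obtain ⟨d, rfl⟩ := g.exists_dart a
  obtain ⟨e, rfl⟩ := g.exists_dart b
  have key : ∀ f, g.Reach d f → g.vert f ∈ S := by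
    intro f hf
    unfold Reach at hf
    induction hf with
    | refl => exact ha
    | tail _ hcd ih =>
      obtain hcd | hcd := hcd
      · rwa [← hcd]
      · rw [← hcd]; exact hcon _ ih
  exact hb (key e (hg d e))

lemma IsPath.exists_extension {g : CubicGraph n} (hg : g.Connected) {k : ℕ}
    {s : ℕ → Fin (6 * n)} {v : ℕ → Fin (2 * n)} (hp : g.IsPath k s v) (hk : k + 1 < 2 * n) :
    ∃ h s' v', SwapReach g h ∧ h.IsPath (k + 1) s' v' := by
  have hb : ∃ b, b ∉ v '' Set.Iic k := by
    by_contra! hcon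
    have h1 : (Finset.univ : Finset (Fin (2 * n))) ⊆ (Finset.range (k + 1)).image v := by
      intro b _
      obtain ⟨i, hi, rfl⟩ := hcon b
      exact Finset.mem_image_of_mem _ (by simpa [Nat.lt_succ_iff] using hi)
    have h2 := (Finset.card_le_card h1).trans Finset.card_image_le
    simp at h2
    omega
  obtain ⟨b, hb⟩ := hb
  obtain ⟨y, ⟨i, hi, hyi⟩, hy⟩ :=
    hg.exists_boundary_dart (Set.mem_image_of_mem v (Set.mem_Iic.2 (Nat.zero_le k))) hb
  have hyo : g.OffPath k s y := by
    refine fun j hj => ⟨?_, ?_⟩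
    · rintro rfl
      exact hy ⟨j + 1, hj, (hp.vert_dinv_eq j hj).symm⟩
    · rintro rfl
      rw [g.dinv_invol] at hy
      exact hy ⟨j, hj.le, (hp.vert_eq j hj).symm⟩
  obtain ⟨q, hqv, hqo⟩ := hp.exists_offPath le_rfl
  have hp' := hp.swapDarts hyo hqo
  have hyk : (g.swapDarts y q).vert y = v k := by rw [vert_swapDarts_left, hqv]
  have hyd : (g.swapDarts y q).vert (g.dinv y) = g.vert (g.dinv y) := by
    refine vert_swapDarts_of_ne _ (g.dinv_ne y) ?_
    rintro rfl
    exact hy ⟨k, Set.mem_Iic.2 le_rfl, hqv.symm⟩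
  refine ⟨g.swapDarts y q, Function.update s k y, Function.update v (k + 1) (g.vert (g.dinv y)),
    hp.swapReach hi le_rfl hyo hqo hyi.symm hqv, ?_, ?_, ?_⟩
  · intro j hj
    rw [Function.update_of_ne (by omega : j ≠ k + 1)]
    obtain rfl | hjk := eq_or_ne j k
    · rw [Function.update_self, hyk]
    · rw [Function.update_of_ne hjk, hp'.vert_eq j (by omega)]
  · intro j hj
    obtain rfl | hjk := eq_or_ne j k
    · rw [Function.update_self, Function.update_self]; exact hyd
    · rw [Function.update_of_ne hjk, Function.update_of_ne (by omega),
        hp'.vert_dinv_eq j (by omega)]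
  · have hnew : ∀ j ≤ k, v j ≠ g.vert (g.dinv y) := fun j hj h => hy ⟨j, hj, h⟩
    intro a ha c hc hac
    simp only [Function.update_apply] at hac
    split_ifs at hac with h1 h2 h2
    · omega
    · exact absurd hac.symm (hnew c (by omega))
    · exact absurd hac (hnew a (by omega))
    · exact hp.inj a (by omega) c (by omega) hac

lemma Connected.exists_isPath {g : CubicGraph n} (hg : g.Connected) (k : ℕ) (hk : k < 2 * n) :
    ∃ h s v, SwapReach g h ∧ h.IsPath k s v := by
  induction k with
  | zero =>
    exact ⟨g, fun _ => ⟨0, by omega⟩, fun _ => ⟨0, hk⟩, .refl g, by simp, by simp,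
      fun i hi j hj _ => by omega⟩
  | succ k ih =>
    obtain ⟨h, s, v, hgh, hp⟩ := ih (by omega)
    obtain ⟨h', s', v', hh', hp'⟩ := hp.exists_extension (hgh.connected hg) hk
    exact ⟨h', s', v', hgh.trans hh', hp'⟩

/-! ### Graphs sharing a Hamiltonian path -/

lemma IsPath.exists_eq {g : CubicGraph n} {k : ℕ} {s : ℕ → Fin (6 * n)} {v : ℕ → Fin (2 * n)}
    (hp : g.IsPath k s v) (hk : k + 1 = 2 * n) (w : Fin (2 * n)) : ∃ i ≤ k, v i = w := by
  have hinj : Function.Injective fun i : Fin (2 * n) => v i := fun i j hij =>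
    Fin.ext (hp.inj i (by omega) j (by omega) hij)
  obtain ⟨i, hi⟩ := (Finite.injective_iff_surjective.1 hinj) w
  exact ⟨i, by omega, hi⟩

lemma IsPath.swapReach_of_common {h : CubicGraph n} {k : ℕ} {s : ℕ → Fin (6 * n)}
    {v : ℕ → Fin (2 * n)} (hph : h.IsPath k s v) (hk : k + 1 = 2 * n) (m : ℕ) :
    ∀ {g : CubicGraph n}, g.IsPath k s v → (∀ d, g.dinv d = h.dinv d) →
      (Finset.univ.filter fun d => g.vert d ≠ h.vert d).card = m → SwapReach g h := by
  induction m using Nat.strong_induction_on with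
  | _ m ih =>
    intro g hpg hd hm
    by_cases hgh : g = h
    · exact hgh ▸ .refl g
    obtain ⟨d, hdv⟩ : ∃ d, g.vert d ≠ h.vert d := by
      by_contra! hcon
      exact hgh (ext_vert_dinv hcon hd)
    obtain ⟨e, he, he'⟩ : ∃ e, g.vert e = h.vert d ∧ h.vert e ≠ h.vert d := by
      by_contra! hcon
      have hsub : (Finset.univ.filter fun e => g.vert e = h.vert d)
          ⊆ Finset.univ.filter fun e => h.vert e = h.vert d := by
        intro e he
        simpa using hcon e (by simpa using he)
      have heq := Finset.eq_of_subset_of_card_le hsub (by rw [g.regular, h.regular])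
      have hmem : d ∈ Finset.univ.filter fun e => g.vert e = h.vert d := by rw [heq]; simp
      exact hdv (by simpa using hmem)
    have hoff : ∀ f, g.vert f ≠ h.vert f → g.OffPath k s f := by
      refine fun f hf i hi => ⟨?_, ?_⟩
      · rintro rfl; exact hf (by rw [hpg.vert_eq i hi, hph.vert_eq i hi])
      · rintro rfl
        exact hf (by rw [hpg.vert_dinv_eq i hi, hd, hph.vert_dinv_eq i hi])
    have hev : g.vert e ≠ h.vert e := by rw [he]; exact he'.symm
    obtain ⟨i, hi, hdi⟩ := hpg.exists_eq hk (g.vert d)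
    obtain ⟨j, hj, hej⟩ := hpg.exists_eq hk (g.vert e)
    refine (hpg.swapReach hi hj (hoff d hdv) (hoff e hev) hdi.symm hej.symm).trans
      (ih _ ?_ (hpg.swapDarts (hoff d hdv) (hoff e hev)) hd rfl)
    rw [← hm]
    refine Finset.card_lt_card ((Finset.ssubset_iff_of_subset ?_).2 ⟨d, by simpa using hdv, ?_⟩)
    · intro f hf
      simp only [Finset.mem_filter, Finset.mem_univ, true_and] at hf ⊢
      by_cases hfd : f = d
      · exact hfd ▸ hdv
      by_cases hfe : f = e
      · exact hfe ▸ hev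
      rwa [vert_swapDarts_of_ne _ hfd hfe] at hf
    · simp [vert_swapDarts_left, he]

end CubicGraph

/-! ### Conjugating fixed-point-free involutions -/

lemma Equiv.Perm.exists_conj_of_involutive {α : Type*} [Fintype α] [DecidableEq α] {f g : α → α}
    (hf : Function.Involutive f) (hg : Function.Involutive g) (hf' : ∀ d, f d ≠ d)
    (hg' : ∀ d, g d ≠ d) : ∃ φ : Equiv.Perm α, ∀ d, φ (f d) = g (φ d) := by
  have key : ∀ e : α → α, ∀ he : Function.Involutive e, (∀ d, e d ≠ d) →
      (he.toPerm e).cycleType = Multiset.replicate (Fintype.card α / 2) 2 := by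
    intro e he he'
    have h1 : (he.toPerm e) ^ 2 = 1 := by
      ext d; simp [sq, he d]
    have h2 := Equiv.Perm.cycleType_of_pow_prime_eq_one h1
    have h3 : (he.toPerm e).support = Finset.univ := by
      ext d; simp [he' d]
    have h4 := Equiv.Perm.sum_cycleType (he.toPerm e)
    rw [h3, Finset.card_univ, h2, Multiset.sum_replicate, smul_eq_mul] at h4
    rw [h2, ← h4, Nat.mul_div_cancel _ (by norm_num)]
  obtain ⟨φ, hφ⟩ := isConj_iff.1 (Equiv.Perm.isConj_of_cycleType_eq
    ((key f hf hf').trans (key g hg hg').symm))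
  refine ⟨φ, fun d => ?_⟩
  have := congrArg (fun σ => σ (φ d)) hφ
  simpa using this

lemma Equiv.Perm.exists_commute_involutive_map_eq {α : Type*} [DecidableEq α] {f : α → α}
    (hf : Function.Involutive f) (hf' : ∀ d, f d ≠ d) (k : ℕ) {s t : ℕ → α}
    (hs : ∀ i < k, ∀ j < k, i ≠ j → s i ≠ s j ∧ s i ≠ f (s j))
    (ht : ∀ i < k, ∀ j < k, i ≠ j → t i ≠ t j ∧ t i ≠ f (t j)) :
    ∃ φ : Equiv.Perm α, (∀ d, φ (f d) = f (φ d)) ∧ ∀ i < k, φ (s i) = t i := by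
  induction k with
  | zero => exact ⟨Equiv.refl α, fun _ => rfl, by simp⟩
  | succ k ih =>
    obtain ⟨φ, hφ, hst⟩ := ih (fun i hi j hj => hs i (by omega) j (by omega))
      (fun i hi j hj => ht i (by omega) j (by omega))
    obtain ⟨ψ, hψ, hψk, hψo⟩ : ∃ ψ : Equiv.Perm α, (∀ d, ψ (f d) = f (ψ d)) ∧
        ψ (φ (s k)) = t k ∧ ∀ d, d ≠ φ (s k) → d ≠ f (φ (s k)) → d ≠ t k → d ≠ f (t k) →
          ψ d = d := by
      generalize φ (s k) = a
      generalize t k = b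
      have hff : ∀ d, f (f d) = d := hf
      by_cases hab : b = f a ∨ b = a
      · refine ⟨Equiv.swap a b, ?_, by simp, ?_⟩
        · intro d
          simp only [Equiv.swap_apply_def]
          grind
        · intro d h1 _ h2 _
          exact Equiv.swap_apply_of_ne_of_ne h1 h2
      · refine ⟨Equiv.swap a b * Equiv.swap (f a) (f b), ?_, ?_, ?_⟩
        · intro d
          simp only [Equiv.Perm.mul_apply, Equiv.swap_apply_def]
          grind
        · simp only [Equiv.Perm.mul_apply, Equiv.swap_apply_def]
          grind
        · intro d h1 h2 h3 h4
          simp [Equiv.swap_apply_of_ne_of_ne, *]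
    refine ⟨ψ * φ, fun d => by simp [hφ, hψ], fun i hi => ?_⟩
    obtain rfl | hik := eq_or_ne i k
    · simpa using hψk
    have hi' : i < k := by omega
    rw [Equiv.Perm.mul_apply]
    have h1 := hs i hi k (by omega) hik
    have h2 := ht i hi k (by omega) hik
    rw [hψo, hst i hi']
    · exact φ.injective.ne h1.1
    · rw [← hφ]; exact φ.injective.ne h1.2
    · rw [hst i hi']; exact h2.1
    · rw [hst i hi']; exact h2.2

namespace CubicGraph

variable {n : ℕ}

/-! ### Any two connected graphs are equivalent -/

lemma IsPath.ne_of_ne {g : CubicGraph n} {k : ℕ} {s : ℕ → Fin (6 * n)} {v : ℕ → Fin (2 * n)}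
    (hp : g.IsPath k s v) {i j : ℕ} (hi : i < k) (hj : j < k) (hij : i ≠ j) :
    s i ≠ s j ∧ s i ≠ g.dinv (s j) := by
  refine ⟨fun h => hij ?_, fun h => ?_⟩
  · exact hp.inj i hi.le j hj.le (by rw [← hp.vert_eq i hi, ← hp.vert_eq j hj, h])
  · have h1 : i = j + 1 := hp.inj i hi.le (j + 1) hj
      (by rw [← hp.vert_eq i hi, ← hp.vert_dinv_eq j hj, h])
    have h2 : i + 1 = j := hp.inj (i + 1) hi j hj.le
      (by rw [← hp.vert_eq j hj, ← hp.vert_dinv_eq i hi, h, g.dinv_invol])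
    omega

lemma IsPath.relabel {g : CubicGraph n} {k : ℕ} {s : ℕ → Fin (6 * n)} {v : ℕ → Fin (2 * n)}
    (hp : g.IsPath k s v) (φ : Equiv.Perm (Fin (6 * n))) (τ : Equiv.Perm (Fin (2 * n))) :
    (g.relabel φ τ).IsPath k (φ ∘ s) (τ ∘ v) := by
  refine ⟨fun i hi => ?_, fun i hi => ?_, fun i hi j hj hij => ?_⟩
  · simp [CubicGraph.relabel, hp.vert_eq i hi]
  · simp [CubicGraph.relabel, hp.vert_dinv_eq i hi]
  · exact hp.inj i hi j hj (τ.injective hij)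

lemma IsPath.congr {g : CubicGraph n} {k : ℕ} {s s' : ℕ → Fin (6 * n)} {v v' : ℕ → Fin (2 * n)}
    (hp : g.IsPath k s v) (hs : ∀ i < k, s i = s' i) (hv : ∀ i ≤ k, v i = v' i) :
    g.IsPath k s' v' := by
  refine ⟨fun i hi => ?_, fun i hi => ?_, fun i hi j hj hij => ?_⟩
  · rw [← hs i hi, ← hv i hi.le, hp.vert_eq i hi]
  · rw [← hs i hi, ← hv (i + 1) hi, hp.vert_dinv_eq i hi]
  · exact hp.inj i hi j hj (by rw [hv i hi, hv j hj, hij])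

lemma IsPath.swapReach_of_hamiltonian {g h : CubicGraph n} {k : ℕ} (hk : k + 1 = 2 * n)
    {s t : ℕ → Fin (6 * n)} {v w : ℕ → Fin (2 * n)} (hg : g.IsPath k s v)
    (hh : h.IsPath k t w) : SwapReach g h := by
  obtain ⟨φ, hφ⟩ := Equiv.Perm.exists_conj_of_involutive g.dinv_invol h.dinv_invol g.dinv_ne
    h.dinv_ne
  have hg1 := hg.relabel φ 1
  have hd1 : ∀ d, (g.relabel φ 1).dinv d = h.dinv d := fun d => by
    simp [CubicGraph.relabel, hφ]
  obtain ⟨ψ, hψ, hst⟩ := Equiv.Perm.exists_commute_involutive_map_eq h.dinv_invol h.dinv_ne k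
    (s := φ ∘ s) (t := t)
    (fun i hi j hj hij => by simpa only [hd1] using hg1.ne_of_ne hi hj hij)
    (fun i hi j hj hij => hh.ne_of_ne hi hj hij)
  have hbij : ∀ {g' : CubicGraph n} {s' v'}, g'.IsPath k s' v' →
      Function.Bijective fun i : Fin (2 * n) => v' i := fun hp =>
    Finite.injective_iff_bijective.1 fun i j hij =>
      Fin.ext (hp.inj i (by omega) j (by omega) hij)
  let τ : Equiv.Perm (Fin (2 * n)) :=
    (Equiv.ofBijective _ (hbij hg)).symm.trans (Equiv.ofBijective _ (hbij hh))
  have hτ : ∀ i ≤ k, τ (v i) = w i := by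
    intro i hi
    have : (Equiv.ofBijective _ (hbij hg)).symm (v i) = ⟨i, by omega⟩ := by
      rw [Equiv.symm_apply_eq]; rfl
    simp only [τ, Equiv.trans_apply, this]
    rfl
  have hg2 := (hg1.relabel ψ τ).congr hst hτ
  refine ((g.isIsomorphic_relabel φ 1).trans (isIsomorphic_relabel _ ψ τ)).swapReach.trans
    (hh.swapReach_of_common hk _ hg2 (fun d => ?_) rfl)
  change ψ ((g.relabel φ 1).dinv (ψ.symm d)) = h.dinv d
  rw [hd1, hψ, Equiv.apply_symm_apply]

lemma Connected.swapReach (hn : 1 ≤ n) {g h : CubicGraph n} (hg : g.Connected)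
    (hh : h.Connected) : SwapReach g h := by
  obtain ⟨g', s, v, hgg, hp⟩ := hg.exists_isPath (2 * n - 1) (by omega)
  obtain ⟨h', t, w, hhh, hq⟩ := hh.exists_isPath (2 * n - 1) (by omega)
  exact hgg.trans ((hp.swapReach_of_hamiltonian (by omega) hq).trans hhh.symm)

lemma Connected.exists_isLoop (hn : 1 ≤ n) {g : CubicGraph n} (hg : g.Connected) :
    ∃ h : CubicGraph n, h.Connected ∧ ∃ x, h.IsLoop x := by
  obtain ⟨g', s, v, hgg, hp⟩ := hg.exists_isPath (2 * n - 1) (by omega)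
  have hg' := hgg.connected hg
  obtain ⟨p, hpv, hpo⟩ := hp.exists_offPath (Nat.zero_le _)
  obtain ⟨q, hqv, hqs, hqp⟩ := g'.exists_dart_ne_ne (v 0) (s 0) p
  have hqo := hp.offPath (Nat.zero_le _) hqv hqs (by simp)
  obtain ⟨j, hj, hjv⟩ := hp.exists_eq (by omega) (g'.vert (g'.dinv p))
  refine ⟨_, (hp.swapReach (Nat.zero_le _) hj hqo hpo.dinv hqv hjv.symm).connected hg', p, ?_⟩
  unfold IsLoop
  rw [vert_swapDarts_of_ne _ hqp.symm (g'.dinv_ne p).symm, hpv]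
  exact (vert_swapDarts_right _ _ _).trans hqv

end CubicGraph

/-! ### The graph of graphs -/

lemma isIsomorphic_of_mk_eq {n : ℕ} {g h : {g : CubicGraph n // g.Connected}}
    (hgh : Quot.mk cgIso g = Quot.mk cgIso h) : g.1.IsIsomorphic h.1 := by
  have heq : Equivalence (@cgIso n) :=
    ⟨fun _ => .refl _, fun h => h.symm, fun h h' => h.trans h'⟩
  exact heq.eqvGen_iff.1 (Quot.eqvGen_exact hgh)

lemma edgeMult_pos_of_whStep {n : ℕ} {g h : {g : CubicGraph n // g.Connected}}
    (hs : CubicGraph.WhStep g.1 h.1) :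
    0 < edgeMult n (Quot.mk cgIso g) (Quot.mk cgIso h) := by
  obtain ⟨i, x, hi⟩ := hs.congr (isIsomorphic_of_mk_eq (Quot.out_eq (Quot.mk cgIso g))).symm
    (isIsomorphic_of_mk_eq (Quot.out_eq (Quot.mk cgIso h))).symm
  refine Nat.div_pos ?_ (by norm_num)
  rw [Nat.succ_le_iff, Finite.one_lt_card_iff_nontrivial]
  refine ⟨⟨(i, x), hi⟩, ⟨(i, _), (CubicGraph.wh_dinv _ i x).symm.trans hi⟩, fun h => ?_⟩
  simp only [Subtype.mk.injEq, Prod.mk.injEq, true_and] at h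
  exact CubicGraph.dinv_ne _ x h.symm

lemma adjMatN_pow_add_pos {n : ℕ} {u v w : GammaV n} {k l : ℕ} (h1 : 0 < (adjMatN n ^ k) u v)
    (h2 : 0 < (adjMatN n ^ l) v w) : 0 < (adjMatN n ^ (k + l)) u w := by
  rw [pow_add, Matrix.mul_apply]
  exact Finset.sum_pos' (fun _ _ => Nat.zero_le _) ⟨v, Finset.mem_univ v, Nat.mul_pos h1 h2⟩

lemma exists_adjMatN_pow_pos {n : ℕ} (hn : 1 ≤ n) (u v : GammaV n) :
    ∃ k, 0 < (adjMatN n ^ k) u v := by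
  induction u using Quot.ind with | _ g
  induction v using Quot.ind with | _ h
  obtain ⟨g, hg⟩ := g
  obtain ⟨h, hh⟩ := h
  suffices key : ∀ k (_ : CubicGraph.SwapReach g k) (hk : k.Connected),
      ∃ m, 0 < (adjMatN n ^ m) (Quot.mk cgIso ⟨g, hg⟩) (Quot.mk cgIso ⟨k, hk⟩) from
    key h (hg.swapReach hn hh) hh
  intro k hgk
  unfold CubicGraph.SwapReach at hgk
  induction hgk with
  | refl => exact fun _ => ⟨0, by simp⟩
  | @tail a b hga hab ih =>
    intro hb
    have ha : a.Connected := CubicGraph.SwapReach.connected hga hg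
    obtain ⟨m, hm⟩ := ih ha
    obtain hab | hab := hab
    · refine ⟨m + 1, adjMatN_pow_add_pos hm ?_⟩
      rw [pow_one]
      exact edgeMult_pos_of_whStep (g := ⟨a, ha⟩) (h := ⟨b, hb⟩) hab.whStep
    · have hq : Quot.mk cgIso ⟨a, ha⟩ = Quot.mk cgIso ⟨b, hb⟩ := Quot.sound hab
      exact ⟨m, hq ▸ hm⟩

/-- The adjacency matrix of `Γ_n` is primitive: some (positive) power of it
has all entries strictly positive. -/
theorem adjMat_primitive (n : ℕ) (hn : 1 ≤ n) :
    ∃ k : ℕ, 0 < k ∧ ∀ u v : GammaV n, 0 < (adjMatN n ^ k) u v := by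
  obtain hempty | ⟨⟨u₀⟩⟩ := isEmpty_or_nonempty (GammaV n)
  · exact ⟨1, one_pos, fun u => hempty.elim u⟩
  obtain ⟨g, hg, x, hx⟩ := (Quot.out u₀).2.exists_isLoop hn
  set w : GammaV n := Quot.mk cgIso ⟨g, hg⟩ with hw
  have hww : 0 < (adjMatN n ^ 1) w w := by
    rw [pow_one]
    exact edgeMult_pos_of_whStep
      (CubicGraph.whStep_iff.2 (.inl ⟨⟨x, hx⟩, CubicGraph.IsIsomorphic.refl g⟩))
  have hloop : ∀ m, 0 < (adjMatN n ^ m) w w := by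
    intro m
    induction m with
    | zero => simp
    | succ m ih => exact adjMatN_pow_add_pos ih hww
  choose a ha using fun u => exists_adjMatN_pow_pos hn u w
  choose b hb using fun v => exists_adjMatN_pow_pos hn w v
  refine ⟨∑ u, a u + ∑ v, b v + 1, Nat.succ_pos _, fun u v => ?_⟩
  have h1 : a u ≤ ∑ u, a u := Finset.single_le_sum (fun _ _ => Nat.zero_le _) (Finset.mem_univ u)
  have h2 : b v ≤ ∑ v, b v := Finset.single_le_sum (fun _ _ => Nat.zero_le _) (Finset.mem_univ v)
  have h3 : ∑ u, a u + ∑ v, b v + 1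
      = a u + (∑ u, a u + ∑ v, b v + 1 - a u - b v) + b v := by omega
  rw [h3]
  exact adjMatN_pow_add_pos (adjMatN_pow_add_pos (ha u) (hloop _)) (hb v)
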